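/- arXiv:2601.21417 — 2 statements merged into one kernel-verified Lean document; each statement's English description precedes it below -/
import Mathlib

section
/- Let a₁, a₂ ∈ ℝ² be linearly independent vectors, let Γ := { m·a₁ + n·a₂ : m, n ∈ ℤ } be the lattice they generate, and let Λ₁ := { y₁·a₁ + y₂·a₂ : y₁, y₂ ∈ [−1/2, 1/2] } be the unit cell. Let b ∈ ℝ, let A_per : ℝ² → ℝ² be continuous and Γ-periodic, and set A(x) := (b/2)·(−x₂, x₁) + A_per(x). Let K₁, K₂ : ℝ² × ℝ² → ℂ be JCEL kernels, each satisfying the magnetic periodicity condition (mpc) with respect to A and Γ. Then ∫_{Λ₁} ( ∫_{ℝ²} K₁(x,y)·K₂(y,x) dy ) dx = ∫_{Λ₁} ( ∫_{ℝ²} K₂(x,y)·K₁(y,x) dy ) dx, all integrals converging absolutely. -/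
open MeasureTheory RealInnerProductSpace

noncomputable section

/-- The Euclidean plane `ℝ²`. -/
abbrev R2 : Type := EuclideanSpace ℝ (Fin 2)

/-- Building a vector in `ℝ²` from its two coordinates. -/
noncomputable def vec2 (s t : ℝ) : R2 := (WithLp.equiv 2 (Fin 2 → ℝ)).symm ![s, t]

/-- The lattice `Γ = ℤa₁ + ℤa₂` generated by `a₁, a₂ ∈ ℝ²`. -/
def lattice (a₁ a₂ : R2) : Set R2 := {γ | ∃ m n : ℤ, γ = m • a₁ + n • a₂}

/-- The unit cell `Λ₁ = { y₁a₁ + y₂a₂ : y₁, y₂ ∈ [−1/2, 1/2] }`. -/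
def unitCell (a₁ a₂ : R2) : Set R2 :=
  {x | ∃ y₁ y₂ : ℝ, y₁ ∈ Set.Icc (-(1/2) : ℝ) (1/2) ∧ y₂ ∈ Set.Icc (-(1/2) : ℝ) (1/2) ∧
    x = y₁ • a₁ + y₂ • a₂}

/-- A kernel `K : ℝ² × ℝ² → ℂ` is *jointly continuous exponentially localized* (JCEL) with
localization constants `(C, β)` if it is jointly continuous and
`|K(x,x')| ≤ C·exp(−β·‖x−x'‖)` for all `x, x'`. -/
def JCEL (K : R2 × R2 → ℂ) (C β : ℝ) : Prop :=
  Continuous K ∧ ∀ x x' : R2, ‖K (x, x')‖ ≤ C * Real.exp (-β * ‖x - x'‖)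

/-- The magnetic periodicity condition (mpc) for a kernel `K` with respect to a vector
potential `A` and a lattice `Γ`. -/
def MPC (A : R2 → R2) (Γ : Set R2) (K : R2 × R2 → ℂ) : Prop :=
  ∀ γ ∈ Γ, ∀ x x' : R2,
    Complex.exp (-Complex.I * (⟪A x, γ⟫ : ℝ)) * K (x - γ, x') =
      K (x, x' + γ) * Complex.exp (-Complex.I * (⟪A (x' + γ), γ⟫ : ℝ))

/-- `x ↦ exp (-β‖x‖)` is integrable on the plane. -/
lemma integrable_exp_neg_mul_norm {β : ℝ} (hβ : 0 < β) :
    Integrable (fun x : R2 => Real.exp (-β * ‖x‖)) := by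
  rw [integrable_fun_norm_addHaar volume (f := fun r => Real.exp (-β * r))]
  simpa using integrableOn_rpow_mul_exp_neg_mul_rpow (p := 1) (s := 1) (b := β)
    (by norm_num) one_pos hβ

lemma integrable_exp_neg_mul_norm_sub {β : ℝ} (hβ : 0 < β) (x : R2) :
    Integrable (fun y : R2 => Real.exp (-β * ‖x - y‖)) :=
  (integrable_exp_neg_mul_norm hβ).comp_sub_left x

/-- A continuous, exponentially localized function is integrable in its second variable. -/
lemma JCEL.integrable_right {F : R2 × R2 → ℂ} {C β : ℝ} (hF : JCEL F C β) (hβ : 0 < β) (x : R2) :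
    Integrable (fun y : R2 => F (x, y)) := by
  refine ((integrable_exp_neg_mul_norm_sub hβ x).const_mul C).mono' ?_ ?_
  · exact (hF.1.comp (by fun_prop)).aestronglyMeasurable
  · exact .of_forall fun y => hF.2 x y

lemma JCEL.integrable_prod {F : R2 × R2 → ℂ} {C β : ℝ} (hF : JCEL F C β) (hβ : 0 < β)
    {S : Set R2} (hS : volume S ≠ ⊤) :
    Integrable F ((volume.restrict S).prod volume) := by
  have : IsFiniteMeasure (volume.restrict S) := isFiniteMeasure_restrict.2 hS
  have hm : AEStronglyMeasurable F ((volume.restrict S).prod volume) :=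
    hF.1.aestronglyMeasurable
  rw [integrable_prod_iff hm]
  refine ⟨.of_forall fun x => hF.integrable_right hβ x, ?_⟩
  refine (integrable_const (C * ∫ y : R2, Real.exp (-β * ‖y‖))).mono'
    hm.norm.integral_prod_right' (.of_forall fun x => ?_)
  rw [Real.norm_of_nonneg (integral_nonneg fun y => norm_nonneg _), ← integral_const_mul]
  refine (integral_mono (hF.integrable_right hβ x).norm
    ((integrable_exp_neg_mul_norm_sub hβ x).const_mul C) (fun y => hF.2 x y)).trans_eq ?_
  exact integral_sub_left_eq_self (fun y : R2 => C * Real.exp (-β * ‖y‖)) volume x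

/-- The kernel `(x, y) ↦ K₁(x, y) K₂(y, x)` is exponentially localized. -/
lemma JCEL.mul_swap {K₁ K₂ : R2 × R2 → ℂ} {C₁ β₁ C₂ β₂ : ℝ} (h₁ : JCEL K₁ C₁ β₁)
    (h₂ : JCEL K₂ C₂ β₂) :
    JCEL (fun p => K₁ p * K₂ p.swap) (C₁ * C₂) (β₁ + β₂) := by
  refine ⟨h₁.1.mul (h₂.1.comp continuous_swap), fun x y => ?_⟩
  have hx := h₁.2 x y
  have hy := h₂.2 y x
  rw [norm_sub_rev] at hy
  calc ‖K₁ (x, y) * K₂ (y, x)‖ = ‖K₁ (x, y)‖ * ‖K₂ (y, x)‖ := norm_mul _ _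
    _ ≤ (C₁ * Real.exp (-β₁ * ‖x - y‖)) * (C₂ * Real.exp (-β₂ * ‖x - y‖)) :=
      mul_le_mul hx hy (norm_nonneg _) ((norm_nonneg _).trans hx)
    _ = C₁ * C₂ * Real.exp (-(β₁ + β₂) * ‖x - y‖) := by
      rw [mul_mul_mul_comm, ← Real.exp_add]; ring_nf

/-- Under simultaneous lattice translations, a magnetic periodic kernel picks up a phase. -/
lemma MPC.translate {A : R2 → R2} {Γ : Set R2} {K : R2 × R2 → ℂ} (h : MPC A Γ K) {γ : R2}
    (hγ : γ ∈ Γ) (x y : R2) :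
    K (x - γ, y - γ) = Complex.exp (Complex.I * (⟪A x, γ⟫ : ℝ)) * K (x, y) *
      Complex.exp (-Complex.I * (⟪A y, γ⟫ : ℝ)) := by
  have := h γ hγ x (y - γ)
  rw [sub_add_cancel] at this
  rw [mul_assoc, ← this, ← mul_assoc, ← Complex.exp_add]
  simp

/-- The gauge phases cancel in `K₁(x, y) K₂(y, x)`. -/
lemma MPC.mul_swap_sub {A : R2 → R2} {Γ : Set R2} {K₁ K₂ : R2 × R2 → ℂ} (h₁ : MPC A Γ K₁)
    (h₂ : MPC A Γ K₂) {γ : R2} (hγ : γ ∈ Γ) (x y : R2) :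
    K₁ (x - γ, y - γ) * K₂ (y - γ, x - γ) = K₁ (x, y) * K₂ (y, x) := by
  rw [h₁.translate hγ, h₂.translate hγ]
  have hx : Complex.exp (Complex.I * (⟪A x, γ⟫ : ℝ)) *
      Complex.exp (-Complex.I * (⟪A x, γ⟫ : ℝ)) = 1 := by
    rw [← Complex.exp_add]; simp
  have hy : Complex.exp (Complex.I * (⟪A y, γ⟫ : ℝ)) *
      Complex.exp (-Complex.I * (⟪A y, γ⟫ : ℝ)) = 1 := by
    rw [← Complex.exp_add]; simp
  linear_combination (K₁ (x, y) * K₂ (y, x)) * (hy + (Complex.exp (Complex.I * (⟪A y, γ⟫ : ℝ)) *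
      Complex.exp (-Complex.I * (⟪A y, γ⟫ : ℝ))) * hx)

/-- The additive subgroup of `ℝ²` generated by a basis. -/
abbrev basisLattice (B : Module.Basis (Fin 2) ℝ R2) : AddSubgroup R2 :=
  (Submodule.span ℤ (Set.range B)).toAddSubgroup

instance (L : AddSubgroup R2) : MeasurableConstVAdd L (R2 × R2) where
  measurable_const_vadd g := by
    change Measurable fun p : R2 × R2 => ((g : R2) + p.1, (g : R2) + p.2)
    fun_prop

instance (L : AddSubgroup R2) : VAddInvariantMeasure L (R2 × R2) (volume.prod volume) where
  measure_preimage_vadd g _ hs :=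
    ((measurePreserving_add_left volume (g : R2)).prod
      (measurePreserving_add_left volume (g : R2))).measure_preimage hs.nullMeasurableSet

/-- For a function invariant under diagonal lattice translations, integrating over the strips
`S × ℝ²` and `ℝ² × S` gives the same result when `S` is a translated fundamental domain. -/
lemma setIntegral_prod_univ_eq (B : Module.Basis (Fin 2) ℝ R2) (v : R2) (F : R2 × R2 → ℂ)
    (hF : ∀ γ ∈ Submodule.span ℤ (Set.range B), ∀ x y, F (γ + x, γ + y) = F (x, y)) :
    ∫ p in ((· + v) ⁻¹' ZSpan.fundamentalDomain B) ×ˢ Set.univ, F p ∂(volume.prod volume) =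
      ∫ p in Set.univ ×ˢ ((· + v) ⁻¹' ZSpan.fundamentalDomain B), F p
        ∂(volume.prod volume) := by
  have hD := ZSpan.isAddFundamentalDomain' B (volume : Measure R2)
  have hv := (measurePreserving_add_right (volume : Measure R2) v).quasiMeasurePreserving
  have h₁ : IsAddFundamentalDomain (basisLattice B)
      (((· + v) ⁻¹' ZSpan.fundamentalDomain B) ×ˢ (Set.univ : Set R2))
      ((volume : Measure R2).prod volume) := by
    rw [Set.prod_univ, ← Set.preimage_comp]
    exact hD.preimage_of_equiv (hv.comp Measure.quasiMeasurePreserving_fst)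
      Function.bijective_id fun g x => add_assoc (g : R2) x.1 v
  have h₂ : IsAddFundamentalDomain (basisLattice B)
      ((Set.univ : Set R2) ×ˢ ((· + v) ⁻¹' ZSpan.fundamentalDomain B))
      ((volume : Measure R2).prod volume) := by
    rw [Set.univ_prod, ← Set.preimage_comp]
    exact hD.preimage_of_equiv (hv.comp Measure.quasiMeasurePreserving_snd)
      Function.bijective_id fun g x => add_assoc (g : R2) x.2 v
  have : Countable (basisLattice B) :=
    inferInstanceAs (Countable (Submodule.span ℤ (Set.range B)))
  exact h₁.setIntegral_eq h₂ fun g x => hF g g.2 x.1 x.2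

/-- The unit cell agrees, up to a null set, with a translate of the half-open cell. -/
lemma unitCell_ae_eq (B : Module.Basis (Fin 2) ℝ R2) :
    unitCell (B 0) (B 1) =ᵐ[volume]
      (· + ((1 / 2 : ℝ) • B 0 + (1 / 2 : ℝ) • B 1)) ⁻¹' ZSpan.fundamentalDomain B := by
  set v := (1 / 2 : ℝ) • B 0 + (1 / 2 : ℝ) • B 1 with hv
  have h : unitCell (B 0) (B 1) = (· + v) ⁻¹' parallelepiped B := by
    ext x
    simp only [unitCell, Set.mem_ofPred_eq, Set.mem_preimage, mem_parallelepiped_iff,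
      Fin.sum_univ_two, Set.mem_Icc, Pi.le_def, Fin.forall_fin_two, Pi.zero_apply, Pi.one_apply]
    constructor
    · rintro ⟨s, t, hs, ht, rfl⟩
      refine ⟨![s + 1 / 2, t + 1 / 2], ?_, ?_⟩
      · simp only [Matrix.cons_val_zero, Matrix.cons_val_one]
        refine ⟨⟨?_, ?_⟩, ?_, ?_⟩ <;> linarith [hs.1, hs.2, ht.1, ht.2]
      · simp only [Matrix.cons_val_zero, Matrix.cons_val_one, hv]
        module
    · rintro ⟨t, ht, hx⟩
      refine ⟨t 0 - 1 / 2, t 1 - 1 / 2, ?_, ?_, ?_⟩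
      · constructor <;> linarith [ht.1.1, ht.2.1]
      · constructor <;> linarith [ht.1.2, ht.2.2]
      · rw [eq_sub_of_add_eq hx, hv]
        module
  rw [h]
  exact ((measurePreserving_add_right (volume : Measure R2) v).quasiMeasurePreserving.preimage_ae_eq
    (ZSpan.fundamentalDomain_ae_parallelepiped B volume)).symm

lemma volume_unitCell_ne_top (B : Module.Basis (Fin 2) ℝ R2) :
    volume (unitCell (B 0) (B 1)) ≠ ⊤ := by
  rw [measure_congr (unitCell_ae_eq B), measure_preimage_add_right]
  exact (ZSpan.fundamentalDomain_isBounded B).measure_lt_top.ne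

/-- For an exponentially localized function invariant under diagonal lattice translations, the two
variables may be exchanged in the integral over a unit cell. -/
lemma JCEL.setIntegral_unitCell_swap (B : Module.Basis (Fin 2) ℝ R2) {F : R2 × R2 → ℂ} {C β : ℝ}
    (hF : JCEL F C β) (hβ : 0 < β) (hF' : JCEL (fun p => F p.swap) C β)
    (hinv : ∀ γ ∈ Submodule.span ℤ (Set.range B), ∀ x y, F (γ + x, γ + y) = F (x, y)) :
    ∫ x in unitCell (B 0) (B 1), (∫ y : R2, F (x, y)) =
      ∫ x in unitCell (B 0) (B 1), (∫ y : R2, F (y, x)) := by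
  have hae := unitCell_ae_eq B
  have hfin := volume_unitCell_ne_top B
  rw [measure_congr hae] at hfin
  have hswap :=
    setIntegral_prod_univ_eq B ((1 / 2 : ℝ) • B 0 + (1 / 2 : ℝ) • B 1) F hinv
  rw [← setIntegral_prod_swap Set.univ, ← Measure.prod_restrict,
    Measure.restrict_univ,
    integral_prod _ (hF.integrable_prod hβ hfin),
    integral_prod _ (hF'.integrable_prod hβ hfin)] at hswap
  rw [Measure.restrict_congr_set hae]
  exact hswap

/-- Proposition C.3(ii), cyclicity of the trace per unit area. Let
`A(x) = (b/2)·(−x₂, x₁) + A_per(x)` with `A_per` continuous and `Γ`-periodic. For JCEL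
kernels `K₁, K₂` satisfying the mpc with respect to `A` and `Γ`,
`∫_{Λ₁} (K₁ ∘ K₂)(x,x) dx = ∫_{Λ₁} (K₂ ∘ K₁)(x,x) dx`, all integrals converging
absolutely. -/
theorem stmt_8 (a₁ a₂ : R2) (hlin : LinearIndependent ℝ ![a₁, a₂])
    (b : ℝ) (Aper : R2 → R2) (hAper : Continuous Aper)
    (hAperiodic : ∀ γ ∈ lattice a₁ a₂, ∀ x : R2, Aper (x + γ) = Aper x)
    (A : R2 → R2) (hA : A = fun x => (b/2) • vec2 (-(x 1)) (x 0) + Aper x)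
    (K₁ K₂ : R2 × R2 → ℂ) (C₁ β₁ C₂ β₂ : ℝ)
    (hC₁ : 0 < C₁) (hβ₁ : 0 < β₁) (hC₂ : 0 < C₂) (hβ₂ : 0 < β₂)
    (h₁ : JCEL K₁ C₁ β₁) (h₂ : JCEL K₂ C₂ β₂)
    (h₁mpc : MPC A (lattice a₁ a₂) K₁) (h₂mpc : MPC A (lattice a₁ a₂) K₂) :
    (∀ x : R2, Integrable (fun y : R2 => K₁ (x, y) * K₂ (y, x))) ∧
    (∀ x : R2, Integrable (fun y : R2 => K₂ (x, y) * K₁ (y, x))) ∧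
    IntegrableOn (fun x : R2 => ∫ y : R2, K₁ (x, y) * K₂ (y, x)) (unitCell a₁ a₂) ∧
    IntegrableOn (fun x : R2 => ∫ y : R2, K₂ (x, y) * K₁ (y, x)) (unitCell a₁ a₂) ∧
    ∫ x in unitCell a₁ a₂, (∫ y : R2, K₁ (x, y) * K₂ (y, x)) =
      ∫ x in unitCell a₁ a₂, (∫ y : R2, K₂ (x, y) * K₁ (y, x)) := by
  have hβ : 0 < β₁ + β₂ := add_pos hβ₁ hβ₂
  have hβ' : 0 < β₂ + β₁ := add_pos hβ₂ hβ₁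
  have h₁₂ := h₁.mul_swap h₂
  have h₂₁ := h₂.mul_swap h₁
  have hcomm : (fun p : R2 × R2 => K₂ p * K₁ p.swap) =
      fun p => (fun q : R2 × R2 => K₁ q * K₂ q.swap) p.swap := by
    funext p
    simp [mul_comm]
  obtain ⟨B, rfl, rfl⟩ : ∃ B : Module.Basis (Fin 2) ℝ R2, B 0 = a₁ ∧ B 1 = a₂ :=
    ⟨basisOfLinearIndependentOfCardEqFinrank hlin (by simp), by simp, by simp⟩
  have hfin := volume_unitCell_ne_top B
  refine ⟨h₁₂.integrable_right hβ, h₂₁.integrable_right hβ',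
    (h₁₂.integrable_prod hβ hfin).integral_prod_left,
    (h₂₁.integrable_prod hβ' hfin).integral_prod_left, ?_⟩
  have hinv : ∀ γ ∈ Submodule.span ℤ (Set.range B), ∀ x y,
      K₁ (γ + x, γ + y) * K₂ (γ + y, γ + x) = K₁ (x, y) * K₂ (y, x) := by
    intro γ hγ x y
    have hΓ : γ ∈ lattice (B 0) (B 1) := by
      obtain ⟨c, hc⟩ := (Submodule.mem_span_range_iff_exists_fun ℤ).1 hγ
      exact ⟨c 0, c 1, by rw [← hc, Fin.sum_univ_two]⟩
    simpa using (h₁mpc.mul_swap_sub h₂mpc hΓ (γ + x) (γ + y)).symm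
  rw [add_comm β₂, mul_comm C₂, hcomm] at h₂₁
  refine (h₁₂.setIntegral_unitCell_swap B hβ h₂₁ hinv).trans ?_
  simp [mul_comm]
end
end

section
/- Let a₁, a₂ ∈ ℝ² be linearly independent vectors, let Γ := { m·a₁ + n·a₂ : m, n ∈ ℤ } be the lattice they generate, and let Λ₁ := { y₁·a₁ + y₂·a₂ : y₁, y₂ ∈ [−1/2, 1/2] } be the unit cell. Let b₀ ∈ ℝ, let A_per : ℝ² → ℝ² be continuous and Γ-periodic, and set A(x) := (b₀/2)·(−x₂, x₁) + A_per(x). Let p and B be JCEL kernels, each satisfying the magnetic periodicity condition (mpc) with respect to A and Γ, and assume: (p ∘ p)(x,x') = p(x,x'), p(x,x') = conj(p(x',x)), and (p ∘ (B ∘ p))(x,x') = B(x,x') for all x, x' (i.e. p is the kernel of an orthogonal projection P and B is the kernel of an operator of the form P·A·P). For j ∈ {1,2} define k_j(y,z) := (z_j − y_j)·B(y,z) and c_j := p ∘ (k_j ∘ p). Then ∫_{Λ₁} c_j(x,x) dx = 0. -/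
open MeasureTheory RealInnerProductSpace

noncomputable section

/-- Composition of kernels: `(K₁ ∘ K₂)(x,x') = ∫ K₁(x,y)·K₂(y,x') dy`. -/
noncomputable def compK (K₁ K₂ : R2 × R2 → ℂ) : R2 × R2 → ℂ :=
  fun p => ∫ y : R2, K₁ (p.1, y) * K₂ (y, p.2)

open Module Pointwise in
/-- The integral of a lattice-periodic function over a fundamental domain is translation
invariant. -/
lemma setIntegral_fundamentalDomain_add_right {ι : Type*} [Finite ι] (b : Basis ι ℝ R2)
    {g : R2 → ℂ} (hg : ∀ γ ∈ Submodule.span ℤ (Set.range b), ∀ x, g (γ + x) = g x) (v : R2) :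
    ∫ x in ZSpan.fundamentalDomain b, g (x + v) = ∫ x in ZSpan.fundamentalDomain b, g x := by
  have : Countable (Submodule.span ℤ (Set.range b)).toAddSubgroup :=
    inferInstanceAs (Countable (Submodule.span ℤ (Set.range b)))
  have hs := ZSpan.isAddFundamentalDomain' b (volume : Measure R2)
  have ht := hs.vadd_of_comm v
  have hpre : (fun x : R2 => x + v) ⁻¹' (v +ᵥ ZSpan.fundamentalDomain b) =
      ZSpan.fundamentalDomain b := by
    ext x
    simp [Set.mem_vadd_set_iff_neg_vadd_mem]
  have hmap := (measurePreserving_add_right volume v).setIntegral_preimage_emb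
    (measurableEmbedding_addRight v) g (v +ᵥ ZSpan.fundamentalDomain b)
  rw [hpre] at hmap
  exact hmap.trans (hs.setIntegral_eq ht fun γ x => hg γ γ.2 x).symm

lemma mem_unitCell_iff_add_mem_parallelepiped (a₁ a₂ x : R2) :
    x ∈ unitCell a₁ a₂ ↔ x + (1 / 2 : ℝ) • (a₁ + a₂) ∈ parallelepiped ![a₁, a₂] := by
  rw [mem_parallelepiped_iff]
  constructor
  · rintro ⟨s, t, ⟨hs, hs'⟩, ⟨ht, ht'⟩, rfl⟩
    refine ⟨![s + 1 / 2, t + 1 / 2], ⟨fun i => ?_, fun i => ?_⟩, ?_⟩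
    · fin_cases i <;> simp <;> linarith
    · fin_cases i <;> simp <;> linarith
    · simp only [Fin.sum_univ_two, Matrix.cons_val_zero, Matrix.cons_val_one]
      module
  · rintro ⟨t, ⟨h0, h1⟩, hx⟩
    have h00 := h0 0
    have h01 := h0 1
    have h10 := h1 0
    have h11 := h1 1
    simp only [Pi.zero_apply, Pi.one_apply] at h00 h01 h10 h11
    refine ⟨t 0 - 1 / 2, t 1 - 1 / 2, ⟨by linarith, by linarith⟩, ⟨by linarith, by linarith⟩, ?_⟩
    rw [eq_sub_of_add_eq hx]
    simp only [Fin.sum_univ_two, Matrix.cons_val_zero, Matrix.cons_val_one]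
    module

lemma isCompact_unitCell (a₁ a₂ : R2) : IsCompact (unitCell a₁ a₂) := by
  have h : unitCell a₁ a₂ = (fun q : ℝ × ℝ => q.1 • a₁ + q.2 • a₂) ''
      (Set.Icc (-(1 / 2)) (1 / 2) ×ˢ Set.Icc (-(1 / 2)) (1 / 2)) := by
    ext x
    constructor
    · rintro ⟨s, t, hs, ht, rfl⟩
      exact ⟨(s, t), ⟨hs, ht⟩, rfl⟩
    · rintro ⟨⟨s, t⟩, ⟨hs, ht⟩, rfl⟩
      exact ⟨s, t, hs, ht, rfl⟩
  rw [h]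
  exact (isCompact_Icc.prod isCompact_Icc).image (by fun_prop)

/-- The integral of a `Γ`-periodic function over the unit cell is translation invariant. -/
lemma setIntegral_unitCell_add_right {a₁ a₂ : R2} (hlin : LinearIndependent ℝ ![a₁, a₂])
    {g : R2 → ℂ} (hg : ∀ γ ∈ lattice a₁ a₂, ∀ x, g (x - γ) = g x) (v : R2) :
    ∫ x in unitCell a₁ a₂, g (x + v) = ∫ x in unitCell a₁ a₂, g x := by
  set b := basisOfLinearIndependentOfCardEqFinrank hlin (by simp) with hb
  have hbc : (b : Fin 2 → R2) = ![a₁, a₂] := coe_basisOfLinearIndependentOfCardEqFinrank _ _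
  set c : R2 := (1 / 2 : ℝ) • (a₁ + a₂)
  have hpre : unitCell a₁ a₂ = (fun x => x + c) ⁻¹' parallelepiped b := by
    ext x
    rw [hbc]
    exact mem_unitCell_iff_add_mem_parallelepiped a₁ a₂ x
  have hshift (f : R2 → ℂ) :
      ∫ x in unitCell a₁ a₂, f (x + c) = ∫ x in ZSpan.fundamentalDomain b, f x := by
    rw [hpre, (measurePreserving_add_right volume c).setIntegral_preimage_emb
      (measurableEmbedding_addRight c),
      setIntegral_congr_set (ZSpan.fundamentalDomain_ae_parallelepiped b volume)]
  have hper : ∀ γ ∈ Submodule.span ℤ (Set.range b), ∀ x, g (γ + x) = g x := by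
    intro γ hγ x
    have hγ' : γ ∈ lattice a₁ a₂ := by
      rw [hbc, Matrix.range_cons_cons_empty, Submodule.mem_span_pair] at hγ
      obtain ⟨m, n, h⟩ := hγ
      exact ⟨m, n, h.symm⟩
    simpa using (hg γ hγ' (γ + x)).symm
  have key (w : R2) : ∫ x in unitCell a₁ a₂, g (x + w) =
      ∫ x in ZSpan.fundamentalDomain b, g x := by
    rw [← setIntegral_fundamentalDomain_add_right b hper (w - c), ← hshift]
    congr with x
    congr 1
    abel
  simpa [key v] using (key 0).symm

lemma integrable_exp_neg_mul_norm_R2 {β : ℝ} (hβ : 0 < β) :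
    Integrable fun x : R2 => Real.exp (-β * ‖x‖) := by
  have hdom := (integrable_one_add_norm (E := R2) (μ := volume) (r := 3) (by norm_num)).const_mul
    (6 / β ^ 3 * Real.exp β)
  refine hdom.mono' (by fun_prop) (.of_forall fun x => ?_)
  rw [Real.norm_of_nonneg (Real.exp_pos _).le, Real.rpow_neg (by positivity)]
  have h : (1 + ‖x‖) ^ (3 : ℝ) = (1 + ‖x‖) ^ 3 := by norm_cast
  have hb : (β * (1 + ‖x‖)) ^ 3 / (Nat.factorial 3 : ℕ) ≤ Real.exp (β * (1 + ‖x‖)) :=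
    Real.pow_div_factorial_le_exp _ (by positivity) 3
  have he : Real.exp (-β * ‖x‖) = Real.exp β * (Real.exp (β * (1 + ‖x‖)))⁻¹ := by
    rw [← Real.exp_neg, ← Real.exp_add]
    ring_nf
  rw [h, he]
  have hb' : (Real.exp (β * (1 + ‖x‖)))⁻¹ ≤ ((β * (1 + ‖x‖)) ^ 3 / 6)⁻¹ := by
    gcongr
    simpa [Nat.factorial] using hb
  calc Real.exp β * (Real.exp (β * (1 + ‖x‖)))⁻¹
      ≤ Real.exp β * ((β * (1 + ‖x‖)) ^ 3 / 6)⁻¹ := by gcongr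
    _ = 6 / β ^ 3 * Real.exp β * ((1 + ‖x‖) ^ 3)⁻¹ := by
      field_simp

/-- Exponentially localized, measurable kernels which are covariant under the magnetic
translations by `Γ`. -/
structure IsMagneticLocalized (A : R2 → R2) (Γ : Set R2) (K : R2 × R2 → ℂ) : Prop where
  stronglyMeasurable : StronglyMeasurable K
  exists_bound : ∃ C β : ℝ, 0 ≤ C ∧ 0 < β ∧
    ∀ x y : R2, ‖K (x, y)‖ ≤ C * Real.exp (-β * ‖x - y‖)
  covariant : ∀ γ ∈ Γ, ∀ x y : R2, K (x - γ, y - γ) =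
    Complex.exp (Complex.I * (⟪A x, γ⟫ : ℝ)) * K (x, y) * Complex.exp (-Complex.I * (⟪A y, γ⟫ : ℝ))

/-- The kernel of the commutator of the operator with kernel `K` and the `j`-th position
operator. -/
def positionCommutator (j : Fin 2) (K : R2 × R2 → ℂ) : R2 × R2 → ℂ :=
  fun q => ((q.2 j - q.1 j : ℝ) : ℂ) * K q

/-- The integral of a kernel over the diagonal of `S`. -/
def diagonalTrace (S : Set R2) (K : R2 × R2 → ℂ) : ℂ := ∫ x in S, K (x, x)

lemma diagonalTrace_positionCommutator (S : Set R2) (j : Fin 2) (K : R2 × R2 → ℂ) :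
    diagonalTrace S (positionCommutator j K) = 0 := by
  simp [diagonalTrace, positionCommutator]

lemma exp_neg_mul_norm_le_one {β : ℝ} (hβ : 0 < β) (x : R2) : Real.exp (-β * ‖x‖) ≤ 1 := by
  rw [Real.exp_le_one_iff]
  nlinarith [norm_nonneg x]

lemma JCEL.isMagneticLocalized {A : R2 → R2} {Γ : Set R2} {K : R2 × R2 → ℂ} {C β : ℝ}
    (hC : 0 < C) (hβ : 0 < β) (hK : JCEL K C β) (hmpc : MPC A Γ K) :
    IsMagneticLocalized A Γ K where
  stronglyMeasurable := hK.1.stronglyMeasurable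
  exists_bound := ⟨C, β, hC.le, hβ, hK.2⟩
  covariant γ hγ x y := by
    have h := hmpc γ hγ x (y - γ)
    rw [sub_add_cancel] at h
    rw [mul_assoc, ← h, ← mul_assoc, ← Complex.exp_add]
    simp

namespace IsMagneticLocalized

variable {A : R2 → R2} {Γ : Set R2} {K L N : R2 × R2 → ℂ}

lemma integrable_mul (hK : IsMagneticLocalized A Γ K) (hL : IsMagneticLocalized A Γ L)
    (x z : R2) : Integrable fun y => K (x, y) * L (y, z) := by
  obtain ⟨C, β, hC, hβ, hKb⟩ := hK.exists_bound
  obtain ⟨D, δ, hD, hδ, hLb⟩ := hL.exists_bound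
  refine (((integrable_exp_neg_mul_norm_R2 hβ).comp_sub_left x).const_mul (C * D)).mono'
    ((hK.stronglyMeasurable.comp_measurable (by fun_prop)).mul
      (hL.stronglyMeasurable.comp_measurable (by fun_prop))).aestronglyMeasurable
    (.of_forall fun y => ?_)
  have h := (hLb y z).trans (mul_le_of_le_one_right hD (exp_neg_mul_norm_le_one hδ _))
  calc ‖K (x, y) * L (y, z)‖ ≤ (C * Real.exp (-β * ‖x - y‖)) * D := by
        rw [norm_mul]
        exact mul_le_mul (hKb x y) h (norm_nonneg _) (by positivity)
    _ = C * D * Real.exp (-β * ‖x - y‖) := by ring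

lemma integrableOn_diagonal (hK : IsMagneticLocalized A Γ K) {S : Set R2} (hS : volume S ≠ ⊤) :
    IntegrableOn (fun x => K (x, x)) S := by
  obtain ⟨C, β, hC, hβ, hKb⟩ := hK.exists_bound
  refine (integrableOn_const (C := C) hS).mono'
    (hK.stronglyMeasurable.comp_measurable (by fun_prop)).aestronglyMeasurable
    (.of_forall fun x => ?_)
  simpa using hKb x x

lemma diagonalTrace_add (hK : IsMagneticLocalized A Γ K) (hL : IsMagneticLocalized A Γ L)
    {S : Set R2} (hS : volume S ≠ ⊤) :
    diagonalTrace S (K + L) = diagonalTrace S K + diagonalTrace S L :=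
  integral_add (hK.integrableOn_diagonal hS) (hL.integrableOn_diagonal hS)

/-- The composition of two localized covariant kernels is localized and covariant. -/
lemma compK (hK : IsMagneticLocalized A Γ K) (hL : IsMagneticLocalized A Γ L) :
    IsMagneticLocalized A Γ (compK K L) where
  stronglyMeasurable := by
    have h : StronglyMeasurable fun r : (R2 × R2) × R2 => K (r.1.1, r.2) * L (r.2, r.1.2) :=
      (hK.stronglyMeasurable.comp_measurable (by fun_prop)).mul
        (hL.stronglyMeasurable.comp_measurable (by fun_prop))
    exact h.integral_prod_right'
  exists_bound := by
    obtain ⟨C, β, hC, hβ, hKb⟩ := hK.exists_bound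
    obtain ⟨D, δ, hD, hδ, hLb⟩ := hL.exists_bound
    set m := min β δ
    have hm : 0 < m := lt_min hβ hδ
    refine ⟨C * D * ∫ y : R2, Real.exp (-(m / 2) * ‖y‖), m / 2, ?_, by positivity, ?_⟩
    · exact mul_nonneg (by positivity) (integral_nonneg fun _ => (Real.exp_pos _).le)
    intro x z
    have hint := ((integrable_exp_neg_mul_norm_R2 (half_pos hm)).comp_sub_left x).const_mul
      (C * D * Real.exp (-(m / 2) * ‖x - z‖))
    refine (norm_integral_le_of_norm_le hint (.of_forall fun y => ?_)).trans_eq ?_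
    · have hexp : Real.exp (-β * ‖x - y‖) * Real.exp (-δ * ‖y - z‖) ≤
          Real.exp (-(m / 2) * ‖x - z‖) * Real.exp (-(m / 2) * ‖x - y‖) := by
        rw [← Real.exp_add, ← Real.exp_add]
        apply Real.exp_le_exp.2
        have h1 : m * ‖x - y‖ ≤ β * ‖x - y‖ := by gcongr; exact min_le_left _ _
        have h2 : m * ‖y - z‖ ≤ δ * ‖y - z‖ := by gcongr; exact min_le_right _ _
        have h3 : m * ‖x - z‖ ≤ m * (‖x - y‖ + ‖y - z‖) := by
          gcongr
          exact norm_sub_le_norm_sub_add_norm_sub x y z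
        nlinarith [mul_nonneg hm.le (norm_nonneg (y - z))]
      calc ‖K (x, y) * L (y, z)‖
          ≤ (C * Real.exp (-β * ‖x - y‖)) * (D * Real.exp (-δ * ‖y - z‖)) := by
            rw [norm_mul]
            exact mul_le_mul (hKb x y) (hLb y z) (norm_nonneg _) (by positivity)
        _ = C * D * (Real.exp (-β * ‖x - y‖) * Real.exp (-δ * ‖y - z‖)) := by ring
        _ ≤ C * D * (Real.exp (-(m / 2) * ‖x - z‖) * Real.exp (-(m / 2) * ‖x - y‖)) := by gcongr
        _ = _ := by ring
    · rw [integral_const_mul,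
        integral_sub_left_eq_self (fun y : R2 => Real.exp (-(m / 2) * ‖y‖)) volume x]
      ring
  covariant γ hγ x z := by
    simp only [_root_.compK]
    rw [← integral_sub_right_eq_self _ γ, ← integral_const_mul, ← integral_mul_const]
    congr with y
    rw [hK.covariant γ hγ, hL.covariant γ hγ]
    have h : Complex.exp (-Complex.I * (⟪A y, γ⟫ : ℝ)) * Complex.exp (Complex.I * (⟪A y, γ⟫ : ℝ))
        = 1 := by
      rw [← Complex.exp_add]
      simp
    linear_combination (Complex.exp (Complex.I * (⟪A x, γ⟫ : ℝ)) * K (x, y) * L (y, z) *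
      Complex.exp (-Complex.I * (⟪A z, γ⟫ : ℝ))) * h

lemma positionCommutator (hK : IsMagneticLocalized A Γ K) (j : Fin 2) :
    IsMagneticLocalized A Γ (positionCommutator j K) where
  stronglyMeasurable := by
    have h : Continuous fun q : R2 × R2 => ((q.2 j - q.1 j : ℝ) : ℂ) := by fun_prop
    exact h.stronglyMeasurable.mul hK.stronglyMeasurable
  exists_bound := by
    obtain ⟨C, β, hC, hβ, hKb⟩ := hK.exists_bound
    refine ⟨C * (2 / β), β / 2, by positivity, by positivity, fun x y => ?_⟩
    have h1 : ‖((y j - x j : ℝ) : ℂ)‖ ≤ ‖x - y‖ := by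
      rw [Complex.norm_real, norm_sub_rev, ← PiLp.sub_apply]
      exact PiLp.norm_apply_le (x - y) j
    have h2 : ‖x - y‖ ≤ 2 / β * Real.exp (β / 2 * ‖x - y‖) := by
      have h := Real.add_one_le_exp (β / 2 * ‖x - y‖)
      calc ‖x - y‖ = 2 / β * (β / 2 * ‖x - y‖) := by field_simp
        _ ≤ _ := by gcongr; linarith
    calc ‖((y j - x j : ℝ) : ℂ) * K (x, y)‖
        ≤ (2 / β * Real.exp (β / 2 * ‖x - y‖)) * (C * Real.exp (-β * ‖x - y‖)) := by
          rw [norm_mul]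
          exact mul_le_mul (h1.trans h2) (hKb x y) (norm_nonneg _) (by positivity)
      _ = C * (2 / β) * (Real.exp (β / 2 * ‖x - y‖) * Real.exp (-β * ‖x - y‖)) := by ring
      _ = C * (2 / β) * Real.exp (-(β / 2) * ‖x - y‖) := by
          rw [← Real.exp_add]
          ring_nf
  covariant γ hγ x y := by
    simp only [_root_.positionCommutator, hK.covariant γ hγ, PiLp.sub_apply, sub_sub_sub_cancel_right]
    ring

lemma compK_assoc (hK : IsMagneticLocalized A Γ K) (hL : IsMagneticLocalized A Γ L)
    (hN : IsMagneticLocalized A Γ N) :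
    _root_.compK (_root_.compK K L) N = _root_.compK K (_root_.compK L N) := by
  ext ⟨x, z⟩
  simp only [_root_.compK, ← integral_mul_const, ← integral_const_mul]
  rw [integral_integral_swap]
  · simp only [mul_assoc]
  obtain ⟨C, β, hC, hβ, hKb⟩ := hK.exists_bound
  obtain ⟨D, δ, hD, hδ, hLb⟩ := hL.exists_bound
  obtain ⟨E, ε, hE, hε, hNb⟩ := hN.exists_bound
  have hdom := ((((integrable_exp_neg_mul_norm_R2 hε).comp_sub_right z).mul_prod
    ((integrable_exp_neg_mul_norm_R2 hβ).comp_sub_left x))).const_mul (C * D * E)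
  refine hdom.mono' (((hK.stronglyMeasurable.comp_measurable (by fun_prop)).mul
    (hL.stronglyMeasurable.comp_measurable (by fun_prop))).mul
      (hN.stronglyMeasurable.comp_measurable (by fun_prop))).aestronglyMeasurable
    (.of_forall fun q => ?_)
  have h := (hLb q.2 q.1).trans (mul_le_of_le_one_right hD (exp_neg_mul_norm_le_one hδ _))
  calc ‖K (x, q.2) * L (q.2, q.1) * N (q.1, z)‖
      ≤ (C * Real.exp (-β * ‖x - q.2‖)) * D * (E * Real.exp (-ε * ‖q.1 - z‖)) := by
        rw [norm_mul, norm_mul]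
        gcongr
        · exact hKb _ _
        · exact hNb _ _
    _ = C * D * E * (Real.exp (-ε * ‖q.1 - z‖) * Real.exp (-β * ‖x - q.2‖)) := by ring

/-- The commutator with a position operator is a derivation. -/
lemma positionCommutator_compK (hK : IsMagneticLocalized A Γ K)
    (hL : IsMagneticLocalized A Γ L) (j : Fin 2) :
    _root_.positionCommutator j (_root_.compK K L) =
      _root_.compK (_root_.positionCommutator j K) L +
        _root_.compK K (_root_.positionCommutator j L) := by
  ext ⟨x, z⟩
  have h := integral_add ((hK.positionCommutator j).integrable_mul hL x z)
    (hK.integrable_mul (hL.positionCommutator j) x z)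
  refine Eq.trans ?_ h
  simp only [_root_.positionCommutator, _root_.compK, ← integral_const_mul]
  congr with y
  push_cast
  ring

/-- The trace per unit cell is cyclic. -/
lemma diagonalTrace_compK_comm {a₁ a₂ : R2} (hlin : LinearIndependent ℝ ![a₁, a₂])
    (hK : IsMagneticLocalized A (lattice a₁ a₂) K) (hL : IsMagneticLocalized A (lattice a₁ a₂) L) :
    diagonalTrace (unitCell a₁ a₂) (_root_.compK K L) =
      diagonalTrace (unitCell a₁ a₂) (_root_.compK L K) := by
  obtain ⟨C, β, hC, hβ, hKb⟩ := hK.exists_bound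
  obtain ⟨D, δ, hD, hδ, hLb⟩ := hL.exists_bound
  have hfin : volume (unitCell a₁ a₂) ≠ ⊤ := (isCompact_unitCell a₁ a₂).measure_lt_top.ne
  have hbound (x y : R2) : ‖K (x, y) * L (y, x)‖ ≤ C * D * Real.exp (-β * ‖x - y‖) := by
    have h := (hLb y x).trans (mul_le_of_le_one_right hD (exp_neg_mul_norm_le_one hδ _))
    calc ‖K (x, y) * L (y, x)‖ ≤ (C * Real.exp (-β * ‖x - y‖)) * D := by
          rw [norm_mul]
          exact mul_le_mul (hKb x y) h (norm_nonneg _) (by positivity)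
      _ = C * D * Real.exp (-β * ‖x - y‖) := by ring
  have hdom : Integrable (fun q : R2 × R2 => C * D * Real.exp (-β * ‖q.2‖))
      ((volume.restrict (unitCell a₁ a₂)).prod volume) := by
    simpa using (((integrableOn_const (C := (1 : ℝ)) hfin).mul_prod
      (integrable_exp_neg_mul_norm_R2 hβ))).const_mul (C * D)
  have hint₁ : Integrable (fun q : R2 × R2 => K (q.1, q.1 + q.2) * L (q.1 + q.2, q.1))
      ((volume.restrict (unitCell a₁ a₂)).prod volume) := by
    refine hdom.mono' ((hK.stronglyMeasurable.comp_measurable (by fun_prop)).mul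
      (hL.stronglyMeasurable.comp_measurable (by fun_prop))).aestronglyMeasurable
      (.of_forall fun q => ?_)
    simpa using hbound q.1 (q.1 + q.2)
  have hint₂ : Integrable (fun q : R2 × R2 => K (q.1 - q.2, q.1) * L (q.1, q.1 - q.2))
      ((volume.restrict (unitCell a₁ a₂)).prod volume) := by
    refine hdom.mono' ((hK.stronglyMeasurable.comp_measurable (by fun_prop)).mul
      (hL.stronglyMeasurable.comp_measurable (by fun_prop))).aestronglyMeasurable
      (.of_forall fun q => ?_)
    simpa using hbound (q.1 - q.2) q.1
  have hper : ∀ γ ∈ lattice a₁ a₂, ∀ x y : R2,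
      K (x - γ, y - γ) * L (y - γ, x - γ) = K (x, y) * L (y, x) := by
    intro γ hγ x y
    have h (z : R2) : Complex.exp (Complex.I * (⟪A z, γ⟫ : ℝ)) *
        Complex.exp (-Complex.I * (⟪A z, γ⟫ : ℝ)) = 1 := by
      rw [← Complex.exp_add]
      simp
    rw [hK.covariant γ hγ, hL.covariant γ hγ]
    linear_combination (K (x, y) * L (y, x) * Complex.exp (Complex.I * (⟪A y, γ⟫ : ℝ)) *
      Complex.exp (-Complex.I * (⟪A y, γ⟫ : ℝ))) * h x + K (x, y) * L (y, x) * h y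
  calc ∫ x in unitCell a₁ a₂, ∫ y, K (x, y) * L (y, x)
      = ∫ x in unitCell a₁ a₂, ∫ v, K (x, x + v) * L (x + v, x) := by
        congr with x
        exact (integral_add_left_eq_self (fun y => K (x, y) * L (y, x)) x).symm
    _ = ∫ v, ∫ x in unitCell a₁ a₂, K (x, x + v) * L (x + v, x) := integral_integral_swap hint₁
    _ = ∫ v, ∫ x in unitCell a₁ a₂, K (x - v, x) * L (x, x - v) := by
        congr with v
        rw [← setIntegral_unitCell_add_right hlin (g := fun x => K (x - v, x) * L (x, x - v)) ?_ v]
        · simp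
        · intro γ hγ x
          simpa only [sub_right_comm] using hper γ hγ (x - v) x
    _ = ∫ x in unitCell a₁ a₂, ∫ v, K (x - v, x) * L (x, x - v) :=
        (integral_integral_swap hint₂).symm
    _ = ∫ x in unitCell a₁ a₂, ∫ y, L (x, y) * K (y, x) := by
        congr with x
        rw [integral_sub_left_eq_self (fun y => K (y, x) * L (x, y)) volume x]
        simp only [mul_comm]

end IsMagneticLocalized

/-- Proposition 4.3. Let `p` be the JCEL, magnetic periodic kernel of an
orthogonal projection `P` (`p∘p = p`, `p` hermitian) and let `B` be a JCEL, magnetic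
periodic kernel with `p∘(B∘p) = B` (i.e. `B` is the kernel of an operator `P·A·P`). Then
the diagonal integral over the unit cell of `c_j := p ∘ (k_j ∘ p)`, the kernel of the
commutator `[P·A·P, P·X_j·P]` where `k_j(y,z) = (z_j − y_j)·B(y,z)`, vanishes. -/
theorem stmt_11 (a₁ a₂ : R2) (hlin : LinearIndependent ℝ ![a₁, a₂])
    (b₀ : ℝ) (Aper : R2 → R2) (hAper : Continuous Aper)
    (hAperiodic : ∀ γ ∈ lattice a₁ a₂, ∀ x : R2, Aper (x + γ) = Aper x)
    (A : R2 → R2) (hA : A = fun x => (b₀/2) • vec2 (-(x 1)) (x 0) + Aper x)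
    (p B : R2 × R2 → ℂ) (Cp βp CB βB : ℝ)
    (hCp : 0 < Cp) (hβp : 0 < βp) (hCB : 0 < CB) (hβB : 0 < βB)
    (hp : JCEL p Cp βp) (hB : JCEL B CB βB)
    (hpmpc : MPC A (lattice a₁ a₂) p) (hBmpc : MPC A (lattice a₁ a₂) B)
    (hidem : ∀ x x' : R2, compK p p (x, x') = p (x, x'))
    (hherm : ∀ x x' : R2, p (x, x') = (starRingEnd ℂ) (p (x', x)))
    (hPAP : ∀ x x' : R2, compK p (compK B p) (x, x') = B (x, x'))
    (j : Fin 2) :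
    ∫ x in unitCell a₁ a₂,
        compK p (compK (fun q : R2 × R2 => ((q.2 j - q.1 j : ℝ) : ℂ) * B q) p) (x, x)
      = 0 := by
  have hfin : volume (unitCell a₁ a₂) ≠ ⊤ := (isCompact_unitCell a₁ a₂).measure_lt_top.ne
  have hP : IsMagneticLocalized A (lattice a₁ a₂) p := hp.isMagneticLocalized hCp hβp hpmpc
  have hB' : IsMagneticLocalized A (lattice a₁ a₂) B := hB.isMagneticLocalized hCB hβB hBmpc
  have hDp := hP.positionCommutator j
  have hDB := hB'.positionCommutator j
  have hpp : compK p p = p := by ext ⟨x, y⟩; exact hidem x y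
  have hpBp : compK p (compK B p) = B := by ext ⟨x, y⟩; exact hPAP x y
  have hpB : compK p B = B := by
    conv_lhs => rw [← hpBp, ← hP.compK_assoc hP (hB'.compK hP), hpp, hpBp]
  have hBp : compK B p = B := by
    conv_lhs => rw [← hpBp, hP.compK_assoc (hB'.compK hP) hP, hB'.compK_assoc hP hP, hpp, hpBp]
  change diagonalTrace (unitCell a₁ a₂) (compK p (compK (positionCommutator j B) p)) = 0
  have hcyc : diagonalTrace (unitCell a₁ a₂) (compK p (compK (positionCommutator j B) p)) =
      diagonalTrace (unitCell a₁ a₂) (compK (positionCommutator j B) p) := by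
    rw [hP.diagonalTrace_compK_comm hlin (hDB.compK hP), hDB.compK_assoc hP hP, hpp]
  have hsum : diagonalTrace (unitCell a₁ a₂) (compK (positionCommutator j B) p) +
      diagonalTrace (unitCell a₁ a₂) (compK B (positionCommutator j p)) = 0 := by
    rw [← (hDB.compK hP).diagonalTrace_add (hB'.compK hDp) hfin,
      ← hB'.positionCommutator_compK hP, diagonalTrace_positionCommutator]
  have hzero : diagonalTrace (unitCell a₁ a₂) (compK B (positionCommutator j p)) = 0 := by
    have hleib : compK B (positionCommutator j p) =
        compK B (compK (positionCommutator j p) p) + compK B (compK p (positionCommutator j p)) := by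
      conv_lhs => rw [← hpp, hP.positionCommutator_compK hP]
      ext ⟨x, z⟩
      simpa [compK, mul_add] using integral_add (hB'.integrable_mul (hDp.compK hP) x z)
        (hB'.integrable_mul (hP.compK hDp) x z)
    have hdouble := (hB'.compK (hDp.compK hP)).diagonalTrace_add (hB'.compK (hP.compK hDp)) hfin
    rw [← hleib, ← hB'.compK_assoc hP hDp, hBp, ← hB'.compK_assoc hDp hP,
      (hB'.compK hDp).diagonalTrace_compK_comm hlin hP, ← hP.compK_assoc hB' hDp, hpB] at hdouble
    simpa using hdouble
  rw [hcyc, ← hsum, hzero, add_zero]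
end
end
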